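/- arXiv:1610.04699 — 7 statements merged into one kernel-verified Lean document; each statement's English description precedes it below -/
import Mathlib

section
/- Let S be a finite meet-semilattice with least element 0 and greatest element 1, and let s ∈ S be an element with at least two lower covers. Then cov₁(s) = ⋂_{t ∈ Anc(s)} cov₁(t), i.e., for all a, a′ ∈ S one has s⊓a = s⊓a′ if and only if t⊓a = t⊓a′ for every lower cover t of s. -/
/-- `cov₁ s` is the set of first-kind one-variable equations `x ⊓ a = x ⊓ a′`
(given as ordered pairs `(a, a′)`) satisfied by `s`. -/
def cov₁ {S : Type*} [SemilatticeInf S] (s : S) : Set (S × S) :=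
  {p : S × S | s ⊓ p.1 = s ⊓ p.2}

/-- An element with two distinct lower covers inherits inequalities between meets from its
lower covers. -/
theorem inf_le_of_forall_covBy {S : Type*} [SemilatticeInf S] [Finite S] {s t₁ t₂ a b : S}
    (h₁ : t₁ ⋖ s) (h₂ : t₂ ⋖ s) (hne : t₁ ≠ t₂) (h : ∀ t, t ⋖ s → t ⊓ a ≤ b) :
    s ⊓ a ≤ b := by
  rcases (inf_le_left : s ⊓ a ≤ s).eq_or_lt with hs | hs
  · have key : ∀ t, t ⋖ s → t ≤ s ⊓ b := fun t ht =>
      le_inf ht.le ((le_inf le_rfl (ht.le.trans (inf_eq_left.mp hs))).trans (h t ht))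
    rcases (inf_le_left : s ⊓ b ≤ s).eq_or_lt with hb | hb
    · exact hs.le.trans (inf_eq_left.mp hb)
    · have eq_of_covBy : ∀ t, t ⋖ s → t = s ⊓ b := fun t ht =>
        (key t ht).eq_of_not_lt fun hlt => ht.2 hlt hb
      exact absurd ((eq_of_covBy t₁ h₁).trans (eq_of_covBy t₂ h₂).symm) hne
  · obtain ⟨t, hle, ht⟩ := hs.exists_le_covby
    exact (le_inf hle inf_le_right).trans (h t ht)

/-- If `s` has at least two lower covers, then
`cov₁ s = ⋂_{t ⋖ s} cov₁ t`. -/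
theorem stmt_7 (S : Type*) [Fintype S] [SemilatticeInf S] [OrderBot S] [OrderTop S]
    (s : S) (t₁ t₂ : S) (h₁ : t₁ ⋖ s) (h₂ : t₂ ⋖ s) (hne : t₁ ≠ t₂) :
    cov₁ s = ⋂ t ∈ {t : S | t ⋖ s}, cov₁ t := by
  ext ⟨a, b⟩
  simp only [cov₁, Set.mem_ofPred_eq, Set.mem_iInter]
  refine ⟨fun h t ht => ?_, fun h => le_antisymm ?_ ?_⟩
  · rw [← inf_eq_left.mpr ht.le, inf_assoc, inf_assoc, h]
  · exact le_inf inf_le_left (inf_le_of_forall_covBy h₁ h₂ hne fun t ht =>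
      (h t ht).le.trans inf_le_right)
  · exact le_inf inf_le_left (inf_le_of_forall_covBy h₁ h₂ hne fun t ht =>
      (h t ht).ge.trans inf_le_right)
end

section
/- Let S be a finite meet-semilattice with least element 0 and greatest element 1, and let s ∈ S have a unique lower cover s′. Then cov₁(s) = cov₁(s′) \ ({(a,a′) : a ≥ s, a′ ≥ s′, a′ ≱ s} ∪ {(a,a′) : a′ ≥ s, a ≥ s′, a ≱ s}); that is, a pair (a,a′) satisfies s⊓a = s⊓a′ if and only if s′⊓a = s′⊓a′ and it is not the case that exactly one of a, a′ lies above s while the other lies above s′ but not above s. -/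
theorem inf_eq_inf_of_forall_lt_le {S : Type*} [SemilatticeInf S] {s s' a : S} (hle : s' ≤ s)
    (h : ∀ t < s, t ≤ s') (ha : ¬ s ≤ a) : s ⊓ a = s' ⊓ a :=
  le_antisymm (le_inf (h _ (inf_lt_left.2 ha)) inf_le_right) (inf_le_inf_right a hle)

/-- If `s` has a unique lower cover `s′`, then `cov₁ s` is obtained from `cov₁ s′`
by removing the pairs `(a, a′)` where exactly one of `a, a′` lies above `s` while
the other lies above `s′` but not above `s`. -/
theorem stmt_8 (S : Type*) [Fintype S] [SemilatticeInf S] [OrderBot S] [OrderTop S]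
    (s s' : S) (hcov : s' ⋖ s) (huniq : ∀ t : S, t ⋖ s → t = s') :
    cov₁ s = cov₁ s' \
      ({p : S × S | s ≤ p.1 ∧ s' ≤ p.2 ∧ ¬ s ≤ p.2} ∪
       {p : S × S | s ≤ p.2 ∧ s' ≤ p.1 ∧ ¬ s ≤ p.1}) := by
  have hle : s' ≤ s := hcov.le
  have hlt : ∀ t < s, t ≤ s' := fun t ht => by
    obtain ⟨x, htx, hx⟩ := exists_le_covBy_of_lt ht
    exact huniq x hx ▸ htx
  have key {a : S} (ha : ¬ s ≤ a) : s ⊓ a = s' ⊓ a := inf_eq_inf_of_forall_lt_le hle hlt ha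
  ext ⟨a, b⟩
  simp only [cov₁, Set.mem_ofPred_eq, Set.mem_sdiff, Set.mem_union]
  by_cases ha : s ≤ a <;> by_cases hb : s ≤ b
  · simp [ha, hb, hle.trans ha, hle.trans hb]
  · have hne : s ≠ s ⊓ b := fun h => hb (left_eq_inf.1 h)
    simp [ha, hb, hle.trans ha, hne]
  · have hne : s ⊓ a ≠ s := fun h => ha (inf_eq_left.1 h)
    simp [ha, hb, hle.trans hb, hne]
  · simp [ha, hb, key ha, key hb]
end

section
/- Let S be a finite meet-semilattice with least element 0 and greatest element 1 of order n, and let a ∈ S be an atom. Then cov₁(a) = {(s,t) ∈ S×S : s ≥ a and t ≥ a} ∪ {(s,t) ∈ S×S : s ≱ a and t ≱ a}, and consequently |cov₁(a)| = |↑a|² + (n − |↑a|)², where ↑a = {t ∈ S : t ≥ a}. -/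
theorem IsAtom.mem_cov₁_iff {S : Type*} [SemilatticeInf S] [OrderBot S] {a : S}
    (ha : IsAtom a) (p : S × S) : p ∈ cov₁ a ↔ (a ≤ p.1 ↔ a ≤ p.2) := by
  have inf_eq_bot_of_not_le {t : S} (ht : ¬ a ≤ t) : a ⊓ t = ⊥ :=
    (ha.le_iff.mp inf_le_left).resolve_right fun h => ht (inf_eq_left.mp h)
  change a ⊓ p.1 = a ⊓ p.2 ↔ _
  refine ⟨fun h => by rw [← inf_eq_left, h, inf_eq_left], fun h => ?_⟩
  by_cases h₁ : a ≤ p.1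
  · rw [inf_eq_left.mpr h₁, inf_eq_left.mpr (h.mp h₁)]
  · rw [inf_eq_bot_of_not_le h₁, inf_eq_bot_of_not_le (mt h.mpr h₁)]

theorem Set.ncard_prod_self_union_compl_prod_self {α : Type*} [Finite α] (s : Set α) :
    (s ×ˢ s ∪ sᶜ ×ˢ sᶜ).ncard = s.ncard ^ 2 + (Nat.card α - s.ncard) ^ 2 := by
  have hdisj : Disjoint (s ×ˢ s) (sᶜ ×ˢ sᶜ) :=
    Set.disjoint_prod.mpr (Or.inl disjoint_compl_right)
  rw [Set.ncard_union_eq hdisj, Set.ncard_prod, Set.ncard_prod, Set.ncard_compl, sq, sq]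

/-- For an atom `a`, `cov₁ a` consists of the pairs both of whose entries lie above `a`
together with the pairs neither of whose entries lies above `a`; hence
`|cov₁ a| = |↑a|² + (n − |↑a|)²`. -/
theorem stmt_10 (S : Type*) [Fintype S] [SemilatticeInf S] [OrderBot S] [OrderTop S]
    (a : S) (ha : IsAtom a) :
    cov₁ a = {p : S × S | a ≤ p.1 ∧ a ≤ p.2} ∪ {p : S × S | ¬ a ≤ p.1 ∧ ¬ a ≤ p.2} ∧
      Nat.card (cov₁ a) =
        Nat.card {t : S | a ≤ t} ^ 2 +
          (Fintype.card S - Nat.card {t : S | a ≤ t}) ^ 2 := by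
  have hcov : cov₁ a =
      {p : S × S | a ≤ p.1 ∧ a ≤ p.2} ∪ {p : S × S | ¬ a ≤ p.1 ∧ ¬ a ≤ p.2} :=
    Set.ext fun p => (ha.mem_cov₁_iff p).trans iff_iff_and_or_not_and_not
  refine ⟨hcov, ?_⟩
  rw [hcov, ← Nat.card_eq_fintype_card]
  exact Set.ncard_prod_self_union_compl_prod_self {t : S | a ≤ t}
end

section
/- For every finite meet-semilattice S with least element 0 and greatest element 1 of order n ≥ 4, one has Σ_{s∈S} |cov₁(s)| ≤ n² + n + (n−2)·((n−2)² + 4); in other words, the fan semilattice F_n maximizes the total number of (element, first-kind one-variable equation) incidences among all semilattices of order n. -/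
open Finset

theorem le_iff_of_mem_cov₁ {S : Type*} [SemilatticeInf S] {s : S} {p : S × S} (hp : p ∈ cov₁ s) :
    s ≤ p.1 ↔ s ≤ p.2 := by
  have h : s ⊓ p.1 = s ⊓ p.2 := hp
  rw [← inf_eq_left, h, inf_eq_left]

section CovBounds

variable {S : Type*} [Fintype S] [SemilatticeInf S]

theorem cov₁_card_bot [OrderBot S] : Nat.card (cov₁ (⊥ : S)) = Fintype.card S ^ 2 := by
  have h : cov₁ (⊥ : S) = Set.univ := by ext p; simp [cov₁]
  rw [h, Nat.card_univ, Nat.card_prod, Nat.card_eq_fintype_card, sq]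

theorem cov₁_card_top [OrderTop S] : Nat.card (cov₁ (⊤ : S)) = Fintype.card S := by
  have h : cov₁ (⊤ : S) = Set.range fun x : S => (x, x) := by
    ext ⟨a, b⟩
    simp [cov₁]
  rw [h, Nat.card_range_of_injective fun a b hab => (Prod.ext_iff.1 hab).1,
    Nat.card_eq_fintype_card]

open Classical in
theorem cov₁_card_le_add_sq (s : S) :
    Nat.card (cov₁ s) ≤ #{x | s ≤ x} ^ 2 + #{x | ¬ s ≤ x} ^ 2 := by
  have h : cov₁ s ⊆ ↑(({x | s ≤ x} : Finset S) ×ˢ ({x | s ≤ x} : Finset S) ∪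
      ({x | ¬ s ≤ x} : Finset S) ×ˢ ({x | ¬ s ≤ x} : Finset S)) := by
    intro p hp
    have := le_iff_of_mem_cov₁ hp
    simp
    tauto
  rw [Nat.card_coe_set_eq]
  refine (Set.ncard_le_ncard h (Finset.finite_toSet _)).trans ?_
  rw [Set.ncard_coe_finset, sq, sq, ← card_product, ← card_product]
  exact card_union_le _ _

open Classical in
/-- If `s` lies above a nonzero element `a` below every nonzero element, then `⊥` forms a
kernel class of `s ⊓ ·` by itself. -/
theorem cov₁_card_le_one_add_sq [OrderBot S] {s a : S} (ha : a ≠ ⊥)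
    (hmin : ∀ x : S, x ≠ ⊥ → a ≤ x) (has : a ≤ s) :
    Nat.card (cov₁ s) ≤ 1 + #{x | s ≤ x} ^ 2 + #{x | ¬ s ≤ x ∧ x ≠ ⊥} ^ 2 := by
  have hbot (x : S) (hx : s ⊓ x = ⊥) : x = ⊥ := by
    by_contra hne
    exact ha (le_bot_iff.1 (hx ▸ le_inf has (hmin x hne)))
  have h : cov₁ s ⊆ ↑({(⊥, ⊥)} ∪ ({x | s ≤ x} : Finset S) ×ˢ ({x | s ≤ x} : Finset S) ∪
      ({x | ¬ s ≤ x ∧ x ≠ ⊥} : Finset S) ×ˢ ({x | ¬ s ≤ x ∧ x ≠ ⊥} : Finset S)) := by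
    rintro ⟨x, y⟩ hp
    have h₁ := le_iff_of_mem_cov₁ hp
    have h₂ : x = ⊥ ↔ y = ⊥ := by
      have hxy : s ⊓ x = s ⊓ y := hp
      constructor
      · rintro rfl
        exact hbot y (by simpa using hxy.symm)
      · rintro rfl
        exact hbot x (by simpa using hxy)
    simp
    tauto
  rw [Nat.card_coe_set_eq]
  refine (Set.ncard_le_ncard h (Finset.finite_toSet _)).trans ?_
  rw [Set.ncard_coe_finset, sq, sq, ← card_product, ← card_product]
  refine (card_union_le _ _).trans ?_
  gcongr
  exact (card_union_le _ _).trans (by simp)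

open Classical in
theorem two_le_card_filter_le [OrderTop S] {s : S} (hs : s ≠ ⊤) : 2 ≤ #{x | s ≤ x} := by
  rw [← card_pair hs]
  exact card_le_card (by intro x; simp; rintro (rfl | rfl) <;> simp)

variable [OrderBot S] [OrderTop S]

open Classical in
theorem cov₁_card_le_of_not_le {m : ℕ} (hm : Fintype.card S = m + 2) {s x : S} (hs : s ≠ ⊥)
    (hs' : s ≠ ⊤) (hx : x ≠ ⊥) (hsx : ¬ s ≤ x) : Nat.card (cov₁ s) ≤ m ^ 2 + 4 := by
  have h₁ := two_le_card_filter_le hs'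
  have h₂ : 2 ≤ #{x | ¬ s ≤ x} := by
    rw [← card_pair hx]
    exact card_le_card (by intro y; simp; rintro (rfl | rfl) <;> simp [*])
  have h₃ : #{x | s ≤ x} + #{x | ¬ s ≤ x} = m + 2 := by
    rw [card_filter_add_card_filter_not, card_univ, hm]
  refine (cov₁_card_le_add_sq s).trans ?_
  obtain ⟨u, hu⟩ := Nat.exists_eq_add_of_le h₁
  obtain ⟨v, hv⟩ := Nat.exists_eq_add_of_le h₂
  obtain rfl : m = u + v + 2 := by omega
  rw [hu, hv]
  nlinarith [Nat.zero_le (u * v)]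

open Classical in
/-- The atom below all nonzero elements and a suitable second element have, together, no more
equations than two atoms of the fan. -/
theorem exists_cov₁_card_add_le {m : ℕ} (hm : Fintype.card S = m + 2) (hm₂ : 2 ≤ m) {a : S}
    (ha : a ≠ ⊥) (ha' : a ≠ ⊤) (hmin : ∀ x : S, x ≠ ⊥ → a ≤ x) :
    ∃ b : S, b ≠ ⊥ ∧ b ≠ ⊤ ∧ b ≠ a ∧
      Nat.card (cov₁ a) + Nat.card (cov₁ b) ≤ 2 * (m ^ 2 + 4) := by
  have hbt : (⊥ : S) ≠ ⊤ := fun h => ha (le_bot_iff.1 (h ▸ le_top))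
  have hcard : #(({⊥, ⊤, a} : Finset S)ᶜ) = m - 1 := by
    rw [card_compl, hm, card_eq_three.2 ⟨⊥, ⊤, a, hbt, ha.symm, ha'.symm, rfl⟩]
    omega
  have hfa : Nat.card (cov₁ a) ≤ (m + 1) ^ 2 + 1 := by
    have h : ({x | ¬ a ≤ x} : Finset S) = {⊥} := by
      ext x
      simp only [mem_filter, mem_univ, true_and, mem_singleton]
      constructor
      · exact fun h => by_contra fun hx => h (hmin x hx)
      · rintro rfl
        simpa using ha
    have h₃ : #{x | a ≤ x} + #{x | ¬ a ≤ x} = m + 2 := by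
      rw [card_filter_add_card_filter_not, card_univ, hm]
    have := cov₁_card_le_add_sq a
    rw [h, card_singleton] at this h₃
    rwa [show #{x | a ≤ x} = m + 1 by omega] at this
  have hsum (b : S) (hb : b ≠ ⊥) :
      #{x | b ≤ x} + #{x | ¬ b ≤ x ∧ x ≠ ⊥} = m + 1 := by
    have h₃ : #{x | b ≤ x} + #{x | ¬ b ≤ x} = m + 2 := by
      rw [card_filter_add_card_filter_not, card_univ, hm]
    have h : ({x | ¬ b ≤ x} : Finset S) = insert ⊥ ({x | ¬ b ≤ x ∧ x ≠ ⊥} : Finset S) := by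
      ext x
      by_cases hx : x = ⊥ <;> simp [hx, hb]
    rw [h, card_insert_of_notMem (by simp)] at h₃
    omega
  have hle (b : S) (hb : b ≠ ⊥) (hba : b ≠ a) : ¬ b ≤ a :=
    fun h => hba (le_antisymm h (hmin b hb))
  have key (b c : S) (hb : b ≠ ⊥) (hb' : b ≠ ⊤) (hba : b ≠ a) (hc : c ≠ ⊥) (hca : c ≠ a)
      (hbc : ¬ b ≤ c) : Nat.card (cov₁ a) + Nat.card (cov₁ b) ≤ 2 * (m ^ 2 + 4) := by
    have h₁ := two_le_card_filter_le hb'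
    have h₂ : 2 ≤ #{x | ¬ b ≤ x ∧ x ≠ ⊥} := by
      rw [← card_pair hca]
      refine card_le_card ?_
      intro y
      simp only [mem_insert, mem_singleton, mem_filter, mem_univ, true_and]
      rintro (rfl | rfl)
      · exact ⟨hbc, hc⟩
      · exact ⟨hle b hb hba, ha⟩
    have h₃ := hsum b hb
    have h₄ := cov₁_card_le_one_add_sq ha hmin (hmin b hb)
    obtain ⟨u, hu⟩ := Nat.exists_eq_add_of_le h₁
    obtain ⟨v, hv⟩ := Nat.exists_eq_add_of_le h₂
    obtain rfl : m = u + v + 3 := by omega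
    rw [hu, hv] at h₄
    nlinarith [Nat.zero_le (u * v)]
  obtain rfl | hm₃ := hm₂.eq_or_lt
  · obtain ⟨b, hb⟩ := card_pos.1 (by omega : 0 < #(({⊥, ⊤, a} : Finset S)ᶜ))
    simp only [mem_compl, mem_insert, mem_singleton, not_or] at hb
    obtain ⟨hb, hb', hba⟩ := hb
    refine ⟨b, hb, hb', hba, ?_⟩
    have h₁ := two_le_card_filter_le hb'
    have h₂ : 0 < #{x | ¬ b ≤ x ∧ x ≠ ⊥} := card_pos.2 ⟨a, by simp [hle b hb hba, ha]⟩
    have h₃ := hsum b hb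
    have h₄ := cov₁_card_le_one_add_sq ha hmin (hmin b hb)
    rw [show #{x | b ≤ x} = 2 by omega, show #{x | ¬ b ≤ x ∧ x ≠ ⊥} = 1 by omega] at h₄
    omega
  · obtain ⟨b, hb, c, hc, hbc⟩ :=
      one_lt_card.1 (by omega : 1 < #(({⊥, ⊤, a} : Finset S)ᶜ))
    simp only [mem_compl, mem_insert, mem_singleton, not_or] at hb hc
    by_cases h : b ≤ c
    · exact ⟨c, hc.1, hc.2.1, hc.2.2, key c b hc.1 hc.2.1 hc.2.2 hb.1 hb.2.2
        fun h' => hbc (le_antisymm h h')⟩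
    · exact ⟨b, hb.1, hb.2.1, hb.2.2, key b c hb.1 hb.2.1 hb.2.2 hc.1 hc.2.2 h⟩

end CovBounds

/-- For any semilattice `S` of order `n ≥ 4`,
`Σ_{s∈S} |cov₁(s)| ≤ n² + n + (n−2)((n−2)² + 4)`,
the right-hand side being the corresponding sum for the fan semilattice `F_n`. -/
theorem stmt_13 (S : Type*) [Fintype S] [SemilatticeInf S] [OrderBot S] [OrderTop S]
    (hn : 4 ≤ Fintype.card S) :
    ∑ s : S, Nat.card (cov₁ s) ≤
      Fintype.card S ^ 2 + Fintype.card S +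
        (Fintype.card S - 2) * ((Fintype.card S - 2) ^ 2 + 4) := by
  classical
  obtain ⟨m, hm⟩ : ∃ m, Fintype.card S = m + 2 := ⟨_, (Nat.sub_add_cancel (by omega)).symm⟩
  have hm₂ : 2 ≤ m := by omega
  have hbt : (⊥ : S) ≠ ⊤ := by
    intro h
    have : Fintype.card S ≤ 1 := Fintype.card_le_one_iff.2 fun x y =>
      (le_top.trans (h ▸ bot_le)).antisymm (le_top.trans (h ▸ bot_le))
    omega
  have hcard : #(({⊥, ⊤} : Finset S)ᶜ) = m := by
    rw [card_compl, hm, card_pair hbt, Nat.add_sub_cancel]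
  suffices h : ∑ s ∈ ({⊥, ⊤} : Finset S)ᶜ, Nat.card (cov₁ s) ≤ m * (m ^ 2 + 4) by
    rw [← sum_add_sum_compl {⊥, ⊤}, sum_pair hbt, cov₁_card_bot, cov₁_card_top, hm,
      Nat.add_sub_cancel]
    gcongr
  by_cases hex : ∃ a : S, a ≠ ⊥ ∧ a ≠ ⊤ ∧ ∀ x : S, x ≠ ⊥ → a ≤ x
  · obtain ⟨a, ha, ha', hmin⟩ := hex
    obtain ⟨b, hb, hb', hba, hab⟩ := exists_cov₁_card_add_le hm hm₂ ha ha' hmin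
    have hsub : ({a, b} : Finset S) ⊆ ({⊥, ⊤} : Finset S)ᶜ := by
      intro x
      simp only [mem_insert, mem_singleton, mem_compl, not_or]
      rintro (rfl | rfl)
      · exact ⟨ha, ha'⟩
      · exact ⟨hb, hb'⟩
    have hrest : ∑ s ∈ ({⊥, ⊤} : Finset S)ᶜ \ {a, b}, Nat.card (cov₁ s) ≤
        #(({⊥, ⊤} : Finset S)ᶜ \ {a, b}) * (m ^ 2 + 4) := by
      refine sum_le_card_nsmul _ _ _ fun s hs => ?_
      simp only [mem_sdiff, mem_insert, mem_singleton, mem_compl, not_or] at hs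
      exact cov₁_card_le_of_not_le hm hs.1.1 hs.1.2 ha
        fun h => hs.2.1 (le_antisymm h (hmin s hs.1.1))
    rw [card_sdiff_of_subset hsub, hcard, card_pair hba.symm] at hrest
    rw [← sum_sdiff hsub, sum_pair hba.symm]
    calc _ ≤ (m - 2) * (m ^ 2 + 4) + 2 * (m ^ 2 + 4) := add_le_add hrest hab
      _ = m * (m ^ 2 + 4) := by rw [← add_mul, Nat.sub_add_cancel hm₂]
  · rw [← hcard, ← smul_eq_mul, hcard]
    nth_rw 1 [← hcard]
    refine sum_le_card_nsmul _ _ _ fun s hs => ?_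
    simp only [mem_insert, mem_singleton, mem_compl, not_or] at hs
    push Not at hex
    obtain ⟨x, hx, hsx⟩ := hex s hs.1 hs.2
    exact cov₁_card_le_of_not_le hm hs.1 hs.2 hx hsx
end

section
/- Let S be a finite meet-semilattice with least element 0 and greatest element 1 of order n having at least two atoms. Then for every atom a of S, |cov₁(a)| ≤ (n−2)² + 4. -/
theorem IsAtom.inf_eq_inf_iff {S : Type*} [SemilatticeInf S] [OrderBot S] {a : S} (ha : IsAtom a)
    (x y : S) : a ⊓ x = a ⊓ y ↔ (a ≤ x ↔ a ≤ y) := by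
  refine ⟨fun h => by rw [← inf_eq_left, ← inf_eq_left, h], fun h => ?_⟩
  rcases ha.le_iff.1 (inf_le_left : a ⊓ x ≤ a) with hx | hx <;>
    rcases ha.le_iff.1 (inf_le_left : a ⊓ y ≤ a) with hy | hy
  · rw [hx, hy]
  · exact (inf_eq_left.2 (h.2 (inf_eq_left.1 hy))).trans hy.symm
  · exact hx.trans (inf_eq_left.2 (h.1 (inf_eq_left.1 hx))).symm
  · rw [hx, hy]

theorem IsAtom.ne_top_of_ne {S : Type*} [PartialOrder S] [OrderBot S] [OrderTop S]
    {a b : S} (ha : IsAtom a) (hb : IsAtom b) (hab : a ≠ b) : a ≠ ⊤ := by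
  rintro rfl
  exact hab ((ha.le_iff_eq hb.1).1 le_top).symm

open Classical in
theorem IsAtom.card_cov₁ {S : Type*} [Fintype S] [SemilatticeInf S] [OrderBot S]
    {a : S} (ha : IsAtom a) :
    Nat.card (cov₁ a) = (Finset.univ.filter (a ≤ ·)).card ^ 2 +
      (Finset.univ.filter (¬ a ≤ ·)).card ^ 2 := by
  have h : cov₁ a = ↑(Finset.univ.filter (a ≤ ·) ×ˢ Finset.univ.filter (a ≤ ·) ∪
      Finset.univ.filter (¬ a ≤ ·) ×ˢ Finset.univ.filter (¬ a ≤ ·)) := by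
    ext ⟨x, y⟩
    simp only [cov₁, Set.mem_ofPred_eq, ha.inf_eq_inf_iff, Finset.mem_coe, Finset.mem_union,
      Finset.mem_product, Finset.mem_filter, Finset.mem_univ, true_and]
    exact iff_iff_and_or_not_and_not
  rw [h, Nat.card_coe_set_eq, Set.ncard_coe_finset, Finset.card_union_of_disjoint,
    Finset.card_product, Finset.card_product, sq, sq]
  exact Finset.disjoint_product.2 (Or.inl (Finset.disjoint_filter_filter_not _ _ _))

/-- If `S` has at least two atoms, then for every atom `a`,
`|cov₁ a| ≤ (n−2)² + 4`. -/
theorem stmt_14 (S : Type*) [Fintype S] [SemilatticeInf S] [OrderBot S] [OrderTop S]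
    (b c : S) (hb : IsAtom b) (hc : IsAtom c) (hbc : b ≠ c)
    (a : S) (ha : IsAtom a) :
    Nat.card (cov₁ a) ≤ (Fintype.card S - 2) ^ 2 + 4 := by
  classical
  obtain ⟨d, hd, had⟩ : ∃ d : S, IsAtom d ∧ a ≠ d := by
    by_cases h : a = b
    · exact ⟨c, hc, h ▸ hbc⟩
    · exact ⟨b, hb, h⟩
  have hup : 1 < (Finset.univ.filter (a ≤ ·)).card :=
    Finset.one_lt_card.2 ⟨a, by simp, ⊤, by simp, ha.ne_top_of_ne hd had⟩
  have hdown : 1 < (Finset.univ.filter (¬ a ≤ ·)).card :=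
    Finset.one_lt_card.2 ⟨⊥, by simpa using ha.1, d, by simpa [hd.le_iff_eq ha.1] using had,
      hd.1.symm⟩
  rw [ha.card_cov₁, ← Finset.card_univ,
    ← Finset.card_filter_add_card_filter_not (s := Finset.univ) (a ≤ ·)]
  obtain ⟨k, hk⟩ := Nat.exists_eq_add_of_le hup
  obtain ⟨m, hm⟩ := Nat.exists_eq_add_of_le hdown
  rw [hk, hm, show 1 + 1 + k + (1 + 1 + m) - 2 = k + m + 2 by omega]
  nlinarith [Nat.zero_le (k * m)]
end

section
/- Let S be a finite meet-semilattice with least element 0 and greatest element 1 of order n ≥ 2 having exactly one atom a. Then |cov₁(a)| = (n−1)² + 1. -/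
theorem le_of_unique_atom {S : Type*} [Finite S] [PartialOrder S] [OrderBot S] {a : S}
    (huniq : ∀ b : S, IsAtom b → b = a) {x : S} (hx : x ≠ ⊥) : a ≤ x := by
  obtain ⟨b, hb, hbx⟩ := (IsAtomic.eq_bot_or_exists_atom_le x).resolve_left hx
  exact huniq b hb ▸ hbx

theorem cov₁_eq_of_unique_atom {S : Type*} [Finite S] [SemilatticeInf S] [OrderBot S] {a : S}
    (ha : IsAtom a) (huniq : ∀ b : S, IsAtom b → b = a) :
    cov₁ a = insert (⊥, ⊥) (({⊥}ᶜ : Set S) ×ˢ ({⊥}ᶜ : Set S)) := by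
  ext ⟨x, y⟩
  have inf_eq : ∀ {z : S}, z ≠ ⊥ → a ⊓ z = a := fun hz =>
    inf_eq_left.2 (le_of_unique_atom huniq hz)
  by_cases hx : x = ⊥ <;> by_cases hy : y = ⊥ <;>
    simp [cov₁, hx, hy, inf_eq, ha.1, ha.1.symm]

/-- If `S` (of order `n ≥ 2`) has exactly one atom `a`, then `|cov₁ a| = (n−1)² + 1`. -/
theorem stmt_15 (S : Type*) [Fintype S] [SemilatticeInf S] [OrderBot S] [OrderTop S]
    (hn : 2 ≤ Fintype.card S)
    (a : S) (ha : IsAtom a) (huniq : ∀ b : S, IsAtom b → b = a) :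
    Nat.card (cov₁ a) = (Fintype.card S - 1) ^ 2 + 1 := by
  rw [cov₁_eq_of_unique_atom ha huniq, Nat.card_coe_set_eq,
    Set.ncard_insert_of_notMem (by simp) (Set.toFinite _), Set.ncard_prod, Set.ncard_compl,
    Set.ncard_singleton, Nat.card_eq_fintype_card, sq]
end

section
/- For every finite meet-semilattice S with least element 0 and greatest element 1 of order n ≥ 4, the total number of solutions of all one-variable equations over S, Σ(S) = Σ_{eq ∈ Eq₁(S)} |V_S(eq)| (sum over all one-variable equations of both kinds of the cardinality of the solution set), satisfies Σ(S) ≤ 2n² + n + (n−2)·((n−2)² + 4). -/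
/-- The solution set of the first-kind one-variable equation `x ⊓ a = x ⊓ a′`
given by the ordered pair `p = (a, a′)`. -/
def solSet₁ {S : Type*} [SemilatticeInf S] (p : S × S) : Set S :=
  {s : S | s ⊓ p.1 = s ⊓ p.2}

/-- The solution set of the second-kind one-variable equation `x ⊓ a = b`
given by the ordered pair `p = (a, b)`. -/
def solSet₂ {S : Type*} [SemilatticeInf S] (p : S × S) : Set S :=
  {s : S | s ⊓ p.1 = p.2}

/-- The total number of solutions of all one-variable equations over `S`:
`Σ(S) = Σ_{eq ∈ Eq₁(S)} |V_S(eq)|`, the sum over all one-variable equations of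
both kinds (counted as distinct objects) of the cardinalities of their solution sets. -/
noncomputable def totalSolutions (S : Type*) [Fintype S] [SemilatticeInf S] : ℕ :=
  (∑ p : S × S, Nat.card (solSet₁ p)) + (∑ p : S × S, Nat.card (solSet₂ p))

open Finset Classical in
/-- The number of first-kind equations `x ⊓ a = x ⊓ a′` solved by `s`. -/
noncomputable def numSolved {S : Type*} [Fintype S] [SemilatticeInf S] (s : S) : ℕ :=
  #{p : S × S | s ⊓ p.1 = s ⊓ p.2}

open Finset Classical in
/-- The elements above `s`. -/
noncomputable def upperFinset {S : Type*} [Fintype S] [SemilatticeInf S] (s : S) : Finset S :=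
  {x : S | s ≤ x}

theorem le_iff_le_of_inf_eq_inf {S : Type*} [SemilatticeInf S] {s a b : S}
    (h : s ⊓ a = s ⊓ b) : s ≤ a ↔ s ≤ b := by
  rw [← inf_eq_left, h, inf_eq_left]

section

variable {S : Type*} [Fintype S] [SemilatticeInf S]

open Finset

theorem mem_upperFinset {s x : S} : x ∈ upperFinset s ↔ s ≤ x := by
  simp [upperFinset]

theorem totalSolutions_eq :
    totalSolutions S = ∑ s : S, numSolved s + Fintype.card S ^ 2 := by
  classical
  unfold totalSolutions numSolved solSet₁ solSet₂
  congr 1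
  · simp only [Nat.card_eq_fintype_card, Set.coe_ofPred, Fintype.card_subtype, card_filter]
    exact sum_comm
  · simp only [Nat.card_eq_fintype_card, Set.coe_ofPred, Fintype.card_subtype, card_filter,
      Fintype.sum_prod_type]
    calc ∑ a : S, ∑ b : S, ∑ s : S, (if s ⊓ a = b then 1 else 0)
        = ∑ a : S, ∑ s : S, ∑ b : S, (if s ⊓ a = b then 1 else 0) :=
          sum_congr rfl fun a _ => sum_comm
      _ = Fintype.card S ^ 2 := by simp [sq]

theorem numSolved_le_sq_add_sq (s : S) :
    numSolved s ≤ #(upperFinset s) ^ 2 + (Fintype.card S - #(upperFinset s)) ^ 2 := by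
  classical
  rw [sq, sq, ← card_compl, ← card_product, ← card_product]
  refine le_trans (card_le_card ?_) (card_union_le _ _)
  rintro ⟨a, b⟩ h
  have := le_iff_le_of_inf_eq_inf (mem_filter.mp h).2
  simp only [mem_union, mem_product, mem_compl, mem_upperFinset]
  tauto

theorem numSolved_le_sq (s : S) : numSolved s ≤ Fintype.card S ^ 2 := by
  rw [sq, ← Fintype.card_prod]
  exact card_le_univ _

theorem numSolved_top [OrderTop S] : numSolved (⊤ : S) = Fintype.card S := by
  classical
  simp [numSolved, card_filter, Fintype.sum_prod_type, -sum_boole]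

theorem two_le_card_upperFinset [OrderTop S] {s : S} (hs : s ≠ ⊤) : 2 ≤ #(upperFinset s) := by
  classical
  rw [← card_pair hs]
  exact card_le_card fun y hy => by
    rcases mem_insert.mp hy with rfl | hy
    · simp [mem_upperFinset]
    · simp [mem_upperFinset, mem_singleton.mp hy]

theorem card_upperFinset_of_isCoatom [OrderTop S] {t : S} (ht : IsCoatom t) :
    #(upperFinset t) = 2 := by
  classical
  rw [← card_pair ht.1]
  congr 1
  ext y
  simp only [mem_upperFinset, mem_insert, mem_singleton, ht.le_iff]
  tauto

theorem numSolved_le_of_card_add_two_le [OrderTop S] {s : S} (hs : s ≠ ⊤)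
    (h : #(upperFinset s) + 2 ≤ Fintype.card S) :
    numSolved s ≤ (Fintype.card S - 2) ^ 2 + 4 := by
  have h₁ := numSolved_le_sq_add_sq s
  have h₂ := two_le_card_upperFinset hs
  obtain ⟨i, hi⟩ := Nat.exists_eq_add_of_le h₂
  obtain ⟨j, hj⟩ := Nat.exists_eq_add_of_le h
  rw [hi] at hj
  rw [hj, hi] at h₁
  rw [hj]
  have e₁ : 2 + i + 2 + j - (2 + i) = j + 2 := by omega
  have e₂ : 2 + i + 2 + j - 2 = i + j + 2 := by omega
  rw [e₁] at h₁
  rw [e₂]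
  nlinarith [Nat.zero_le (i * j)]

variable [OrderBot S]

theorem numSolved_le_of_inf_ne_bot {t : S} (ht : t ≠ ⊥) (h : ∀ x, t ⊓ x = ⊥ → x = ⊥) :
    numSolved t ≤
      #(upperFinset t) ^ 2 + (Fintype.card S - #(upperFinset t) - 1) ^ 2 + 1 := by
  classical
  have hb : (⊥ : S) ∈ (upperFinset t)ᶜ := by simpa [mem_upperFinset] using ht
  have hc : #((upperFinset t)ᶜ.erase ⊥) = Fintype.card S - #(upperFinset t) - 1 := by
    rw [card_erase_of_mem hb, card_compl]
  rw [← hc, sq, sq, ← card_product, ← card_product, ← card_singleton ((⊥ : S), (⊥ : S))]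
  refine le_trans (card_le_card ?_)
    ((card_union_le _ _).trans (Nat.add_le_add_right (card_union_le _ _) _))
  rintro ⟨a, b⟩ hab
  have e : t ⊓ a = t ⊓ b := (mem_filter.mp hab).2
  have h₁ := le_iff_le_of_inf_eq_inf e
  have h₂ : a = ⊥ ↔ b = ⊥ :=
    ⟨fun ha => h b (by rw [← e, ha, inf_bot_eq]), fun hb => h a (by rw [e, hb, inf_bot_eq])⟩
  simp only [mem_union, mem_product, mem_erase, mem_compl, mem_upperFinset, mem_singleton,
    Prod.mk.injEq]
  tauto

theorem card_upperFinset_lt {s : S} (hs : s ≠ ⊥) : #(upperFinset s) < Fintype.card S :=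
  card_lt_univ_of_notMem (x := ⊥) (by simpa [mem_upperFinset] using hs)

theorem le_of_card_upperFinset {s : S} (hs : s ≠ ⊥)
    (h : #(upperFinset s) + 1 = Fintype.card S) {x : S} (hx : x ≠ ⊥) : s ≤ x := by
  classical
  by_contra hsx
  have h₂ : ({⊥, x} : Finset S) ⊆ (upperFinset s)ᶜ := by
    intro y hy
    rcases mem_insert.mp hy with rfl | hy
    · simpa [mem_upperFinset] using hs
    · simpa [mem_upperFinset, mem_singleton.mp hy] using hsx
  have h₃ := card_le_card h₂
  rw [card_pair hx.symm, card_compl] at h₃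
  omega

theorem sum_numSolved_le [OrderTop S] (hn : 4 ≤ Fintype.card S) :
    ∑ s : S, numSolved s ≤ Fintype.card S ^ 2 + Fintype.card S +
      (Fintype.card S - 2) * ((Fintype.card S - 2) ^ 2 + 4) := by
  classical
  have hbt : (⊥ : S) ≠ ⊤ := by
    have : Nontrivial S := Fintype.one_lt_card_iff_nontrivial.mp (by omega)
    obtain ⟨x, hx⟩ := exists_ne (⊥ : S)
    exact ((bot_lt_iff_ne_bot.mpr hx).trans_le le_top).ne
  set M : Finset S := (univ.erase ⊥).erase ⊤ with hM
  have hT : (⊤ : S) ∈ univ.erase (⊥ : S) := by simp [hbt.symm]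
  have hMc : #M = Fintype.card S - 2 := by
    rw [hM, card_erase_of_mem hT, card_erase_of_mem (mem_univ _), card_univ, Nat.sub_sub]
  have hmem {x : S} : x ∈ M ↔ x ≠ ⊤ ∧ x ≠ ⊥ := by simp [hM]
  rw [← add_sum_erase univ numSolved (mem_univ ⊥), ← add_sum_erase _ numSolved hT, ← hM,
    numSolved_top, ← add_assoc]
  refine add_le_add (Nat.add_le_add_right (numSolved_le_sq _) _) ?_
  set B := (Fintype.card S - 2) ^ 2 + 4 with hB
  by_cases hatom : ∃ a ∈ M, #(upperFinset a) + 1 = Fintype.card S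
  · obtain ⟨a, haM, ha⟩ := hatom
    have ha' := hmem.mp haM
    have hle {x : S} (hx : x ≠ ⊥) : a ≤ x := le_of_card_upperFinset ha'.2 ha hx
    obtain ⟨b, hb⟩ : (M.erase a).Nonempty := by
      rw [← card_pos, card_erase_of_mem haM]; omega
    obtain ⟨hba, hbM⟩ := mem_erase.mp hb
    obtain ⟨t, ht, hbt⟩ := (eq_top_or_exists_le_coatom b).resolve_left (hmem.mp hbM).1
    have hab : a < t := ((hle (hmem.mp hbM).2).lt_of_ne hba.symm).trans_le hbt
    have htb : t ≠ ⊥ := (bot_le.trans_lt hab).ne'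
    have htM : t ∈ M.erase a := mem_erase.mpr ⟨hab.ne', hmem.mpr ⟨ht.1, htb⟩⟩
    have hNt := numSolved_le_of_inf_ne_bot htb fun x hx => by
      by_contra hx'
      exact ha'.2 (le_bot_iff.mp (hx ▸ le_inf hab.le (hle hx')))
    rw [card_upperFinset_of_isCoatom ht] at hNt
    have hNa := numSolved_le_sq_add_sq a
    have hrest : ∑ s ∈ (M.erase a).erase t, numSolved s ≤ #((M.erase a).erase t) • B := by
      refine sum_le_card_nsmul _ _ _ fun s hs => ?_
      simp only [mem_erase, hmem] at hs
      refine numSolved_le_of_card_add_two_le hs.2.2.1 ?_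
      have h₁ := card_upperFinset_lt hs.2.2.2
      by_contra h₂
      exact hs.2.1 (le_antisymm (le_of_card_upperFinset hs.2.2.2 (by omega) ha'.2)
        (hle hs.2.2.2))
    rw [card_erase_of_mem htM, card_erase_of_mem haM, hMc, smul_eq_mul] at hrest
    rw [← add_sum_erase M numSolved haM, ← add_sum_erase _ numSolved htM]
    obtain ⟨k, hk⟩ := Nat.exists_eq_add_of_le hn
    have hu : #(upperFinset a) = k + 3 := by omega
    rw [hu, hk] at hNa
    rw [hk] at hNt hrest hB ⊢
    have e₁ : 4 + k - 2 = k + 2 := by omega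
    have e₂ : 4 + k - (k + 3) = 1 := by omega
    have e₃ : 4 + k - 2 - 1 = k + 1 := by omega
    have e₄ : 4 + k - 2 - 1 - 1 = k := by omega
    rw [e₂] at hNa
    rw [e₃] at hNt
    rw [e₄] at hrest
    rw [e₁] at hB ⊢
    nlinarith
  · push Not at hatom
    rw [← hMc]
    refine (sum_le_card_nsmul _ _ B fun s hs => ?_).trans_eq (smul_eq_mul _ _)
    have h₁ := hmem.mp hs
    have h₂ := card_upperFinset_lt h₁.2
    have h₃ := hatom s hs
    exact numSolved_le_of_card_add_two_le h₁.1 (by omega)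

end

theorem stmt_17 (S : Type*) [Fintype S] [SemilatticeInf S] [OrderBot S] [OrderTop S]
    (hn : 4 ≤ Fintype.card S) :
    totalSolutions S ≤
      2 * Fintype.card S ^ 2 + Fintype.card S +
        (Fintype.card S - 2) * ((Fintype.card S - 2) ^ 2 + 4) := by
  have h := sum_numSolved_le hn
  rw [totalSolutions_eq]
  omega
end
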